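/- arXiv:1612.02473 — 5 statements merged into one kernel-verified Lean document; each statement's English description precedes it below -/
import Mathlib

section
/- Let k ≥ 2 and let P be a Sylow 2-subgroup of the alternating group A_{2^k}. Then P contains a normal subgroup N such that: (i) every nontrivial element of N has order 2 (N is elementary abelian) and |N| = 2^(2^(k-1) - 1); (ii) the quotient P/N is isomorphic to a Sylow 2-subgroup of the symmetric group S_{2^(k-1)}; and (iii) the extension splits, i.e. N has a complement H in P (a subgroup H with H ∩ N trivial and H·N = P), so that P is an internal semidirect product of N by a Sylow 2-subgroup of S_{2^(k-1)}. -/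
open Equiv Equiv.Perm

/-- The base group `α → Perm Bool` of the wreath product acting on the fibres of
`α × Bool → α`. -/
def fibrePermHom (α : Type*) : (α → Perm Bool) →* Perm (α × Bool) where
  toFun := prodCongrRight
  map_one' := rfl
  map_mul' _ _ := rfl

/-- Permutations of `α` act on `α × Bool` through the first factor. -/
def firstFactorHom (α : Type*) : Perm α →* Perm (α × Bool) where
  toFun σ := prodCongr σ (Equiv.refl Bool)
  map_one' := rfl
  map_mul' _ _ := rfl

theorem sign_firstFactorHom {α : Type*} [Fintype α] [DecidableEq α] (σ : Perm α) :
    sign (firstFactorHom α σ) = 1 := by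
  have h : firstFactorHom α σ = prodCongrLeft fun _ : Bool => σ := rfl
  rw [h, sign_prodCongrLeft]
  simp

/-- The wreath product of `Perm Bool` by a permutation group `Q` on `α`. -/
abbrev BoolWreath {α : Type*} (Q : Subgroup (Perm α)) :=
  (α → Perm Bool) ⋊[(mulAutArrow : Perm α →* MulAut (α → Perm Bool)).comp Q.subtype] Q

namespace BoolWreath

variable {α : Type*} (Q : Subgroup (Perm α))

/-- The imprimitive action of the wreath product on `α × Bool`. -/
def toPerm : BoolWreath Q →* Perm (α × Bool) :=
  SemidirectProduct.lift (fibrePermHom α) ((firstFactorHom α).comp Q.subtype) fun q =>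
    MonoidHom.ext fun _ => Equiv.ext fun x =>
      Prod.ext (q.1.apply_symm_apply x.1).symm rfl

theorem toPerm_apply (w : BoolWreath Q) (a : α) (b : Bool) :
    toPerm Q w (a, b) = (w.right.1 a, w.left (w.right.1 a) b) := rfl

theorem toPerm_injective : Function.Injective (toPerm Q) := by
  intro v w h
  have h' : ∀ a b, (v.right.1 a, v.left (v.right.1 a) b) = (w.right.1 a, w.left (w.right.1 a) b) :=
    fun a b => by rw [← toPerm_apply, h, toPerm_apply]
  have hr : v.right = w.right := Subtype.ext (Equiv.ext fun a => congrArg Prod.fst (h' a true))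
  refine SemidirectProduct.ext (funext fun a => Equiv.ext fun b => ?_) hr
  simpa [hr] using congrArg Prod.snd (h' (v.right.1⁻¹ a) b)

theorem card_eq [Finite α] : Nat.card (BoolWreath Q) = 2 ^ Nat.card α * Nat.card Q := by
  rw [SemidirectProduct.card, Nat.card_fun, Nat.card_perm]
  simp

variable [Fintype α] [DecidableEq α]

/-- The elements of the wreath product acting on `α × Bool` by even permutations. -/
def even : Subgroup (BoolWreath Q) := (sign.comp (toPerm Q)).ker

theorem inr_mem_even (q : Q) : SemidirectProduct.inr q ∈ even Q := by
  rw [even, MonoidHom.mem_ker, MonoidHom.comp_apply, toPerm, SemidirectProduct.lift_inr]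
  exact sign_firstFactorHom q.1

theorem two_mul_card_even [Nonempty α] :
    2 * Nat.card (even Q) = 2 ^ Nat.card α * Nat.card Q := by
  have hs : Function.Surjective (sign.comp (toPerm Q)) := by
    intro u
    rcases Int.units_eq_one_or u with rfl | rfl
    · exact ⟨1, map_one _⟩
    · obtain ⟨a⟩ := ‹Nonempty α›
      refine ⟨SemidirectProduct.inl (Pi.mulSingle a (swap false true)), ?_⟩
      rw [MonoidHom.comp_apply, toPerm, SemidirectProduct.lift_inl]
      change sign (prodCongrRight _) = -1
      rw [sign_prodCongrRight, Finset.prod_eq_single a]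
      · simp
      · intro b _ hb
        simp [Pi.mulSingle_eq_of_ne hb]
      · simp
  rw [← card_eq, ← Subgroup.index_mul_card (even Q), even, Subgroup.index_ker,
    MonoidHom.range_eq_top.mpr hs]
  simp

/-- The projection of the even part of the wreath product onto the top group. -/
def evenRight : even Q →* Q := SemidirectProduct.rightHom.comp (even Q).subtype

/-- The top group as a subgroup of the even part of the wreath product. -/
def evenInr : Q →* even Q := SemidirectProduct.inr.codRestrict (even Q) (inr_mem_even Q)

theorem evenRight_evenInr : Function.RightInverse (evenInr Q) (evenRight Q) := fun _ => rfl

theorem mul_self_of_mem_ker_evenRight {x : even Q} (hx : x ∈ (evenRight Q).ker) : x * x = 1 := by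
  have hx' : x.1 ∈ (SemidirectProduct.rightHom : BoolWreath Q →* Q).ker := hx
  rw [← SemidirectProduct.range_inl_eq_ker_rightHom] at hx'
  obtain ⟨b, hb⟩ := hx'
  have h2 : ∀ σ : Perm Bool, σ * σ = 1 := by decide
  apply Subtype.ext
  rw [Subgroup.coe_mul, ← hb, ← map_mul, show b * b = 1 from funext fun a => h2 (b a), map_one]
  rfl

end BoolWreath

/-- A Sylow 2-subgroup of the alternating group on twice as many points as `α` is the even part
of the wreath product of `Perm Bool` by a Sylow 2-subgroup of `Perm α`. -/
theorem nonempty_sylow_alternatingGroup_mulEquiv_even {α β : Type*} [Fintype α] [DecidableEq α]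
    [Fintype β] [DecidableEq β] [Nonempty α] (e : α × Bool ≃ β) (Q : Sylow 2 (Perm α))
    (P : Sylow 2 (alternatingGroup β)) : Nonempty (P ≃* BoolWreath.even Q.toSubgroup) := by
  let j₀ : BoolWreath.even Q.toSubgroup →* alternatingGroup (α × Bool) :=
    ((BoolWreath.toPerm Q.toSubgroup).comp (Subgroup.subtype _)).codRestrict _ fun x => x.2
  let j := e.altCongrHom.toMonoidHom.comp j₀
  have hj : Function.Injective j := fun x y h =>
    Subtype.ext (BoolWreath.toPerm_injective _ (congrArg Subtype.val (e.altCongrHom.injective h)))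
  have hβ : Nat.card β = 2 * Nat.card α := by
    rw [← Nat.card_congr e, Nat.card_prod]
    simp [mul_comm]
  have hn : Nontrivial β := e.symm.nontrivial
  have hA := two_mul_nat_card_alternatingGroup (α := β)
  have hcard : Nat.card j.range = 2 ^ (Nat.card (alternatingGroup β)).factorization 2 := by
    rw [← Nat.card_congr (MonoidHom.ofInjective hj).toEquiv]
    have hE := BoolWreath.two_mul_card_even Q.toSubgroup
    have hQ := Q.card_eq_multiplicity
    rw [Nat.card_perm] at hQ hA
    have hv := padicValNat_factorial_mul (p := 2) (Nat.card α)
    rw [← hβ, ← hA, padicValNat.mul two_ne_zero Nat.card_pos.ne', padicValNat_self] at hv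
    rw [Nat.factorization_def _ Nat.prime_two] at hQ ⊢
    apply Nat.eq_of_mul_eq_mul_left two_pos
    rw [hE, hQ, ← pow_add, ← pow_succ', add_comm, ← hv, add_comm]
  exact ⟨(P.equiv (Sylow.ofCard j.range hcard)).trans (MonoidHom.ofInjective hj).symm⟩

theorem MonoidHom.isComplement'_range_ker_of_rightInverse {G H : Type*} [Group G] [Group H]
    {f : G →* H} {s : H →* G} (hs : Function.RightInverse s f) : s.range.IsComplement' f.ker := by
  apply Subgroup.isComplement'_of_disjoint_and_mul_eq_univ
  · rw [Subgroup.disjoint_def]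
    rintro _ ⟨h, rfl⟩ hk
    rw [MonoidHom.mem_ker, hs] at hk
    rw [hk, map_one]
  · refine Set.eq_univ_of_forall fun g => ⟨s (f g), ⟨f g, rfl⟩, (s (f g))⁻¹ * g, ?_, by simp⟩
    simp [MonoidHom.mem_ker, hs (f g)]


/-- For `k ≥ 2`, a Sylow 2-subgroup `P` of `A_{2^k}` has a normal elementary abelian
subgroup `N` of order `2^(2^(k-1) - 1)` with `P / N` isomorphic to a Sylow 2-subgroup
of `S_{2^(k-1)}`, and the extension splits: `N` has a complement in `P`, so that `P`
is a semidirect product. -/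
theorem stmt_6 (k : ℕ) (hk : 2 ≤ k) (P : Sylow 2 (alternatingGroup (Fin (2 ^ k)))) :
    ∃ N : Subgroup P, N.Normal ∧
      (∀ x ∈ N, x ≠ 1 → orderOf x = 2) ∧
      Nat.card N = 2 ^ (2 ^ (k - 1) - 1) ∧
      (∀ Q : Sylow 2 (Equiv.Perm (Fin (2 ^ (k - 1)))),
        ∀ _ : N.Normal, Nonempty ((P ⧸ N) ≃* Q)) ∧
      (∃ H : Subgroup P, H.IsComplement' N) := by
  obtain ⟨m, rfl⟩ : ∃ m, k = m + 1 := ⟨k - 1, by omega⟩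
  rw [Nat.add_sub_cancel]
  let e : Fin (2 ^ m) × Bool ≃ Fin (2 ^ (m + 1)) :=
    (prodCongr (Equiv.refl _) finTwoEquiv.symm).trans
      (finProdFinEquiv.trans (finCongr (pow_succ 2 m).symm))
  obtain ⟨R⟩ : Nonempty (Sylow 2 (Perm (Fin (2 ^ m)))) := inferInstance
  obtain ⟨g⟩ := nonempty_sylow_alternatingGroup_mulEquiv_even e R P
  let f : P →* R := (BoolWreath.evenRight R.toSubgroup).comp g.toMonoidHom
  let s : R →* P := g.symm.toMonoidHom.comp (BoolWreath.evenInr R.toSubgroup)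
  have hs : Function.RightInverse s f := fun q => by
    simpa [f, s] using BoolWreath.evenRight_evenInr R.toSubgroup q
  have hcompl := MonoidHom.isComplement'_range_ker_of_rightInverse hs
  refine ⟨f.ker, inferInstance, fun x hx hx1 => ?_, ?_, fun Q _ => ?_, s.range, hcompl⟩
  · refine orderOf_eq_prime ?_ hx1
    apply g.injective
    rw [sq, map_mul, map_one]
    exact BoolWreath.mul_self_of_mem_ker_evenRight _ hx
  · have hP := hcompl.card_mul_card
    have hE := BoolWreath.two_mul_card_even R.toSubgroup
    rw [← Nat.card_congr g.toEquiv, ← hP,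
      ← Nat.card_congr (MonoidHom.ofInjective hs.injective).toEquiv, Nat.card_fin] at hE
    have hR : 0 < Nat.card R.toSubgroup := Nat.card_pos
    have h2 : 2 ^ (2 ^ m) = 2 * 2 ^ (2 ^ m - 1) := by
      rw [← pow_succ', Nat.sub_add_cancel Nat.one_le_two_pow]
    rw [h2] at hE
    apply Nat.eq_of_mul_eq_mul_left (Nat.mul_pos two_pos hR)
    linarith
  · exact ⟨(QuotientGroup.quotientKerEquivOfRightInverse f s hs).trans (R.equiv Q)⟩
end

section
/- For every k ≥ 1, any Sylow 2-subgroup P of the alternating group A_{2^k} admits a generating set of cardinality k, i.e. there exists a finite set S ⊆ P with |S| = k whose generated subgroup is all of P. -/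
open Equiv

section FiberShift

variable {X : Type*}

/-- The permutation of `X × ZMod 2` translating the fibre over each `x` by `f x`. -/
def fiberShift (f : X → ZMod 2) : Perm (X × ZMod 2) :=
  prodCongrRight fun x => Equiv.addRight (f x)

/-- The action of a permutation of `X` on the first factor of `X × ZMod 2`. -/
def liftFst : Perm X →* Perm (X × ZMod 2) where
  toFun σ := prodCongrLeft fun _ => σ
  map_one' := rfl
  map_mul' _ _ := rfl

@[simp]
theorem fiberShift_apply (f : X → ZMod 2) (p : X × ZMod 2) :
    fiberShift f p = (p.1, p.2 + f p.1) := rfl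

@[simp]
theorem liftFst_apply (σ : Perm X) (p : X × ZMod 2) : liftFst σ p = (σ p.1, p.2) := rfl

theorem fiberShift_zero : fiberShift (0 : X → ZMod 2) = 1 := by
  ext p <;> simp

theorem fiberShift_mul (f g : X → ZMod 2) :
    fiberShift f * fiberShift g = fiberShift (f + g) := by
  ext p
  · simp
  · simp [add_assoc, add_comm (f p.1)]

theorem fiberShift_inv (f : X → ZMod 2) : (fiberShift f)⁻¹ = fiberShift (-f) := by
  rw [inv_eq_iff_mul_eq_one, fiberShift_mul, add_neg_cancel, fiberShift_zero]

theorem liftFst_mul_fiberShift (σ : Perm X) (f : X → ZMod 2) :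
    liftFst σ * fiberShift f = fiberShift (f ∘ σ.symm) * liftFst σ := by
  ext p <;> simp

theorem fiberShift_mul_liftFst_injective :
    Function.Injective fun p : (X → ZMod 2) × Perm X => fiberShift p.1 * liftFst p.2 := by
  rintro ⟨f, σ⟩ ⟨g, τ⟩ h
  have h' : ∀ x, σ x = τ x ∧ f (σ x) = g (τ x) := fun x => by
    simpa using congrArg (fun π : Perm (X × ZMod 2) => π (x, 0)) h
  obtain rfl : σ = τ := Equiv.ext fun x => (h' x).1
  have : f = g := funext fun y => by simpa using (h' (σ.symm y)).2
  rw [this]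

/-- The subgroup of `Perm (X × ZMod 2)` formed by the products of fibre translations by elements
of `A` with lifts of elements of `W`, where `A` is stable under `W`. -/
def fiberProduct (A : AddSubgroup (X → ZMod 2)) (W : Subgroup (Perm X))
    (hA : ∀ σ ∈ W, ∀ f ∈ A, f ∘ σ.symm ∈ A) : Subgroup (Perm (X × ZMod 2)) where
  carrier := (fun p : (X → ZMod 2) × Perm X => fiberShift p.1 * liftFst p.2) ''
    ((A : Set (X → ZMod 2)) ×ˢ (W : Set (Perm X)))
  one_mem' := ⟨(0, 1), ⟨A.zero_mem, W.one_mem⟩, by simp [fiberShift_zero]⟩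
  mul_mem' := by
    rintro _ _ ⟨⟨f, σ⟩, ⟨hf, hσ⟩, rfl⟩ ⟨⟨g, τ⟩, ⟨hg, hτ⟩, rfl⟩
    refine ⟨(f + g ∘ σ.symm, σ * τ), ⟨A.add_mem hf (hA σ hσ g hg), W.mul_mem hσ hτ⟩, ?_⟩
    simp only
    rw [map_mul, ← fiberShift_mul, mul_assoc, mul_assoc, ← mul_assoc (liftFst σ),
      liftFst_mul_fiberShift, mul_assoc]
  inv_mem' := by
    rintro _ ⟨⟨f, σ⟩, ⟨hf, hσ⟩, rfl⟩
    refine ⟨((-f) ∘ (σ⁻¹).symm, σ⁻¹),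
      ⟨hA _ (W.inv_mem hσ) _ (A.neg_mem hf), W.inv_mem hσ⟩, ?_⟩
    simp only
    rw [mul_inv_rev, fiberShift_inv, ← map_inv, liftFst_mul_fiberShift]

theorem card_fiberProduct (A : AddSubgroup (X → ZMod 2)) (W : Subgroup (Perm X))
    (hA : ∀ σ ∈ W, ∀ f ∈ A, f ∘ σ.symm ∈ A) :
    Nat.card (fiberProduct A W hA) = Nat.card A * Nat.card W := by
  have h := Nat.card_image_of_injective (fiberShift_mul_liftFst_injective (X := X))
    ((A : Set (X → ZMod 2)) ×ˢ (W : Set (Perm X)))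
  refine h.trans ?_
  rw [Nat.card_congr (Equiv.Set.prod _ _), Nat.card_prod]
  rfl

/-- The functions whose fibre translations lie in a given subgroup. -/
def shiftsIn (H : Subgroup (Perm (X × ZMod 2))) : AddSubgroup (X → ZMod 2) where
  carrier := {f | fiberShift f ∈ H}
  zero_mem' := by simp [fiberShift_zero]
  add_mem' hf hg := by
    rw [Set.mem_ofPred_eq, ← fiberShift_mul]
    exact H.mul_mem hf hg
  neg_mem' hf := by
    rw [Set.mem_ofPred_eq, ← fiberShift_inv]
    exact H.inv_mem hf

theorem closure_insert_fiberShift (S : Set (Perm X)) (g : X → ZMod 2)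
    (A : AddSubgroup (X → ZMod 2)) (hA : ∀ σ ∈ Subgroup.closure S, ∀ f ∈ A, f ∘ σ.symm ∈ A)
    (hgA : g ∈ A)
    (hgen : ∀ B : AddSubgroup (X → ZMod 2),
      (∀ σ ∈ Subgroup.closure S, ∀ f ∈ B, f ∘ σ.symm ∈ B) → g ∈ B → A ≤ B) :
    Subgroup.closure (insert (fiberShift g) (liftFst '' S)) =
      fiberProduct A (Subgroup.closure S) hA := by
  apply le_antisymm
  · rw [Subgroup.closure_le, Set.insert_subset_iff]
    refine ⟨⟨(g, 1), ⟨hgA, Subgroup.one_mem _⟩, by simp⟩, ?_⟩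
    rintro _ ⟨σ, hσ, rfl⟩
    exact ⟨(0, σ), ⟨A.zero_mem, Subgroup.subset_closure hσ⟩, by simp [fiberShift_zero]⟩
  · set H := Subgroup.closure (insert (fiberShift g) (liftFst '' S)) with hH
    have hlift : ∀ σ ∈ Subgroup.closure S, liftFst σ ∈ H := fun σ hσ => by
      have h : liftFst σ ∈ (Subgroup.closure S).map liftFst := ⟨σ, hσ, rfl⟩
      rw [MonoidHom.map_closure] at h
      exact Subgroup.closure_mono (Set.subset_insert _ _) h
    have hle : A ≤ shiftsIn H := by
      refine hgen _ (fun σ hσ f hf => ?_) (Subgroup.subset_closure (Set.mem_insert _ _))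
      have h := H.mul_mem (H.mul_mem (hlift σ hσ) hf) (H.inv_mem (hlift σ hσ))
      rwa [liftFst_mul_fiberShift, mul_inv_cancel_right] at h
    rintro _ ⟨⟨f, σ⟩, ⟨hf, hσ⟩, rfl⟩
    exact H.mul_mem (hle hf) (hlift σ hσ)

theorem card_closure_insert_fiberShift (S : Set (Perm X)) (g : X → ZMod 2)
    (A : AddSubgroup (X → ZMod 2)) (hA : ∀ σ ∈ Subgroup.closure S, ∀ f ∈ A, f ∘ σ.symm ∈ A)
    (hgA : g ∈ A)
    (hgen : ∀ B : AddSubgroup (X → ZMod 2),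
      (∀ σ ∈ Subgroup.closure S, ∀ f ∈ B, f ∘ σ.symm ∈ B) → g ∈ B → A ≤ B) :
    Nat.card (Subgroup.closure (insert (fiberShift g) (liftFst '' S))) =
      Nat.card A * Nat.card (Subgroup.closure S) := by
  rw [closure_insert_fiberShift S g A hA hgA hgen, card_fiberProduct]

/-- The functions to `ZMod 2` of total weight zero. -/
def evenFunctions (X : Type*) [Fintype X] : AddSubgroup (X → ZMod 2) where
  carrier := {f | ∑ x, f x = 0}
  zero_mem' := by simp
  add_mem' {f g} hf hg := by
    rw [Set.mem_ofPred_eq] at *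
    simp [Finset.sum_add_distrib, hf, hg]
  neg_mem' {f} hf := by
    rw [Set.mem_ofPred_eq] at *
    simp [hf]

theorem mem_evenFunctions [Fintype X] {f : X → ZMod 2} : f ∈ evenFunctions X ↔ ∑ x, f x = 0 := Iff.rfl

variable [DecidableEq X]

theorem single_comp_symm (σ : Perm X) (x : X) :
    (Pi.single x 1 : X → ZMod 2) ∘ σ.symm = Pi.single (σ x) 1 := by
  ext y
  simp [Pi.single_apply, Equiv.symm_apply_eq]

variable [Fintype X]

theorem eq_sum_single (f : X → ZMod 2) : f = ∑ x, (f x).val • (Pi.single x 1 : X → ZMod 2) := by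
  ext y
  simp only [Finset.sum_apply, Pi.smul_apply, Pi.single_apply]
  simp

theorem sign_liftFst (σ : Perm X) : Perm.sign (liftFst σ) = 1 := by
  refine (Perm.sign_prodCongrLeft fun _ => σ).trans ?_
  rw [Finset.prod_const, Finset.card_univ, ZMod.card, Int.units_sq]

theorem sign_fiberShift_single (x : X) :
    Perm.sign (fiberShift (Pi.single x 1 : X → ZMod 2)) =
      Perm.sign (Equiv.addRight (1 : ZMod 2)) := by
  rw [fiberShift, Perm.sign_prodCongrRight, Finset.prod_eq_single x]
  · simp
  · intro y _ hy
    simp [Pi.single_eq_of_ne hy]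
  · simp

theorem sign_fiberShift_single_add_single (x y : X) :
    Perm.sign (fiberShift (Pi.single x 1 + Pi.single y 1 : X → ZMod 2)) = 1 := by
  rw [← fiberShift_mul, map_mul, sign_fiberShift_single, sign_fiberShift_single,
    Int.units_mul_self]

theorem card_evenFunctions_mul_two [Nonempty X] :
    Nat.card (evenFunctions X) * 2 = 2 ^ Fintype.card X := by
  let φ : (X → ZMod 2) →+ ZMod 2 :=
    { toFun := fun f => ∑ x, f x
      map_zero' := by simp
      map_add' := fun f g => by simp [Finset.sum_add_distrib] }
  have hφ : Function.Surjective φ := fun c =>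
    ⟨Pi.single (Classical.arbitrary X) c, Finset.sum_pi_single' _ _ _ |>.trans (by simp)⟩
  have hker : evenFunctions X = φ.ker := rfl
  have h := φ.ker.card_mul_index
  rw [AddSubgroup.index_ker, AddMonoidHom.range_eq_top.mpr hφ] at h
  simpa [hker] using h

end FiberShift

/-- Every equivalence relation invariant under `W` and relating `u` to `v` is total. -/
def OrbitGraphConnected {X : Type*} (W : Subgroup (Perm X)) (u v : X) : Prop :=
  ∀ r : Setoid X, (∀ σ ∈ W, ∀ x y, r x y → r (σ x) (σ y)) → r u v → ∀ x y, r x y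

theorem evenFunctions_le {X : Type*} [Fintype X] [DecidableEq X] {W : Subgroup (Perm X)} {u v : X}
    (hW : OrbitGraphConnected W u v) (B : AddSubgroup (X → ZMod 2))
    (hB : ∀ σ ∈ W, ∀ f ∈ B, f ∘ σ.symm ∈ B) (huv : Pi.single u 1 + Pi.single v 1 ∈ B) :
    evenFunctions X ≤ B := by
  have hself : ∀ x, (Pi.single x 1 + Pi.single x 1 : X → ZMod 2) = 0 := fun x =>
    funext fun _ => CharTwo.add_self_eq_zero _
  let r : Setoid X :=
    { r := fun x y => Pi.single x 1 + Pi.single y 1 ∈ B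
      iseqv :=
        { refl := fun x => by rw [hself]; exact B.zero_mem
          symm := fun h => by rwa [add_comm]
          trans := fun {x y z} h h' => by
            have := B.add_mem h h'
            rwa [add_assoc, ← add_assoc (Pi.single y 1), hself, zero_add] at this } }
  have hr : ∀ x y, Pi.single x 1 + Pi.single y 1 ∈ B := by
    refine hW r (fun σ hσ x y h => ?_) huv
    have := hB σ hσ _ h
    change Pi.single (σ x) 1 + Pi.single (σ y) 1 ∈ B
    rw [← single_comp_symm, ← single_comp_symm]
    exact this
  intro f hf
  have hsum : f = ∑ x, (f x).val • (Pi.single x 1 + Pi.single u 1 : X → ZMod 2) := by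
    simp only [smul_add, Finset.sum_add_distrib]
    rw [← eq_sum_single, left_eq_add]
    have : ∑ x, (f x).val • (1 : ZMod 2) = 0 := by
      simpa using mem_evenFunctions.mp hf
    simp only [← Pi.single_smul]
    ext y
    rw [Finset.sum_apply]
    by_cases hy : y = u
    · subst hy
      simpa using this
    · simp [Pi.single_eq_of_ne hy]
  rw [hsum]
  exact B.sum_mem fun x _ => B.nsmul_mem (hr x u) _

theorem eq_top_of_single_mem {X : Type*} [Fintype X] [DecidableEq X] {W : Subgroup (Perm X)}
    (u : X) (hW : ∀ x, ∃ σ ∈ W, σ u = x) (B : AddSubgroup (X → ZMod 2))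
    (hB : ∀ σ ∈ W, ∀ f ∈ B, f ∘ σ.symm ∈ B) (hu : Pi.single u 1 ∈ B) : ⊤ ≤ B := by
  intro f _
  rw [eq_sum_single f]
  refine B.sum_mem fun x _ => B.nsmul_mem ?_ _
  obtain ⟨σ, hσ, rfl⟩ := hW x
  rw [← single_comp_symm]
  exact hB σ hσ _ hu

/-- For every `k` there is a transitive group of order `2 ^ (2 ^ k - 1)` on `2 ^ k` points, with
`k` generators and a connected orbit graph. -/
theorem exists_transitive_two_group (k : ℕ) :
    ∃ (X : Type) (_ : Fintype X) (_ : DecidableEq X) (S : Finset (Perm X)) (u v : X),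
      Fintype.card X = 2 ^ k ∧ S.card ≤ k ∧
      Nat.card (Subgroup.closure (S : Set (Perm X))) = 2 ^ (2 ^ k - 1) ∧
      (∀ x, ∃ σ ∈ Subgroup.closure (S : Set (Perm X)), σ u = x) ∧
      OrbitGraphConnected (Subgroup.closure (S : Set (Perm X))) u v := by
  induction k with
  | zero =>
    refine ⟨Unit, inferInstance, inferInstance, ∅, (), (), by simp, by simp, by simp,
      fun x => ⟨1, Subgroup.one_mem _, rfl⟩, fun r _ h x y => h⟩
  | succ k ih =>
    obtain ⟨X, _, _, S, u, v, hX, hS, hcard, htrans, hconn⟩ := ih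
    have hgen := fun B => eq_top_of_single_mem u htrans B
    have hinv : ∀ σ ∈ Subgroup.closure (S : Set (Perm X)), ∀ f ∈ (⊤ : AddSubgroup (X → ZMod 2)),
      f ∘ σ.symm ∈ (⊤ : AddSubgroup (X → ZMod 2)) := fun _ _ _ _ => AddSubgroup.mem_top _
    have hcl := closure_insert_fiberShift (S : Set (Perm X)) (Pi.single u 1) ⊤ hinv
      (AddSubgroup.mem_top _) hgen
    have hcoe : ((insert (fiberShift (Pi.single u 1)) (S.image liftFst) :
        Finset (Perm (X × ZMod 2))) : Set (Perm (X × ZMod 2))) =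
        insert (fiberShift (Pi.single u 1)) (liftFst '' (S : Set (Perm X))) := by simp
    refine ⟨X × ZMod 2, inferInstance, inferInstance,
      insert (fiberShift (Pi.single u 1)) (S.image liftFst), (u, 0), (v, 1), ?_, ?_, ?_, ?_, ?_⟩
    · simp [hX, pow_succ]
    · exact (Finset.card_insert_le _ _).trans (Nat.succ_le_succ (Finset.card_image_le.trans hS))
    · rw [hcoe, hcl, card_fiberProduct, hcard, AddSubgroup.card_top, Nat.card_fun,
        Nat.card_zmod, Nat.card_eq_fintype_card, hX, ← pow_add]
      have := Nat.one_le_two_pow (n := k)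
      congr 1
      rw [pow_succ]
      omega
    · rintro ⟨x, b⟩
      obtain ⟨σ, hσ, rfl⟩ := htrans x
      rw [hcoe, hcl]
      exact ⟨_, ⟨(fun _ => b, σ), ⟨AddSubgroup.mem_top _, hσ⟩, rfl⟩, by simp⟩
    · rw [hcoe, hcl]
      intro r hr huv
      have hact : ∀ f : X → ZMod 2, ∀ σ ∈ Subgroup.closure (S : Set (Perm X)), ∀ x y b c,
          r (x, b) (y, c) → r (σ x, b + f (σ x)) (σ y, c + f (σ y)) := fun f σ hσ x y b c h => by
        simpa using hr _ ⟨(f, σ), ⟨AddSubgroup.mem_top _, hσ⟩, rfl⟩ _ _ h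
      have hfiber : ∃ y, r (y, 0) (y, 1) := by
        by_cases h : u = v
        · exact ⟨u, by simpa [h] using huv⟩
        · have h' := hact (Pi.single v 1) 1 (Subgroup.one_mem _) _ _ _ _ huv
          have htwo : (1 + 1 : ZMod 2) = 0 := rfl
          simp only [Perm.coe_one, id_eq, Pi.single_eq_of_ne h, Pi.single_eq_same, add_zero,
            htwo] at h'
          exact ⟨v, r.trans (r.symm h') huv⟩
      have hfibers : ∀ x, r (x, 0) (x, 1) := fun x => by
        obtain ⟨y, hy⟩ := hfiber
        obtain ⟨σ, hσ, rfl⟩ := htrans y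
        obtain ⟨τ, hτ, rfl⟩ := htrans x
        simpa using hact 0 (τ * σ⁻¹) (Subgroup.mul_mem _ hτ (Subgroup.inv_mem _ hσ)) _ _ _ _ hy
      have hbase : ∀ x y, r (x, 0) (y, 0) :=
        hconn (r.comap fun x => (x, 0)) (fun σ hσ x y h => by
          simpa [Setoid.comap_rel] using hact 0 σ hσ x y 0 0 h)
          (r.trans huv (r.symm (hfibers v)))
      have hzero : ∀ x b, r (x, 0) (x, b) := fun x b => by
        fin_cases b
        · exact r.refl _
        · exact hfibers x
      rintro ⟨x, b⟩ ⟨y, c⟩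
      exact r.trans (r.symm (hzero x b)) (r.trans (hbase x y) (hzero y c))

theorem factorization_two_factorial_two_pow (k : ℕ) :
    ((2 ^ k).factorial).factorization 2 = 2 ^ k - 1 := by
  induction k with
  | zero => simp
  | succ k ih =>
    rw [pow_succ', Nat.factorization_factorial_mul Nat.prime_two, ih]
    have := Nat.one_le_two_pow (n := k)
    omega

theorem factorization_two_card_alternatingGroup {k : ℕ} (hk : 1 ≤ k) :
    (Nat.card (alternatingGroup (Fin (2 ^ k)))).factorization 2 = 2 ^ k - 2 := by
  have : Nontrivial (Fin (2 ^ k)) :=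
    Fin.nontrivial_iff_two_le.mpr (by simpa using Nat.pow_le_pow_right two_pos hk)
  have h := congrArg (fun n => n.factorization 2)
    (two_mul_nat_card_alternatingGroup (α := Fin (2 ^ k)))
  rw [Nat.factorization_mul two_ne_zero Nat.card_pos.ne', Finsupp.add_apply,
    Nat.prime_two.factorization_self, Nat.card_perm, Nat.card_fin,
    factorization_two_factorial_two_pow] at h
  omega

/-- A subgroup of `alternatingGroup (Fin (2 ^ k))` of order `2 ^ (2 ^ k - 2)` generated by at most
`k` elements. -/
theorem exists_subgroup_alternatingGroup_rank_le {k : ℕ} (hk : 1 ≤ k) :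
    ∃ K : Subgroup (alternatingGroup (Fin (2 ^ k))),
      Nat.card K = 2 ^ (2 ^ k - 2) ∧ Group.rank K ≤ k := by
  obtain ⟨m, rfl⟩ : ∃ m, k = m + 1 := ⟨k - 1, by omega⟩
  obtain ⟨X, _, _, S, u, v, hX, hS, hcard, -, hconn⟩ := exists_transitive_two_group m
  have hcl := card_closure_insert_fiberShift (S : Set (Perm X))
    (Pi.single u 1 + Pi.single v 1) (evenFunctions X)
    (fun σ _ f hf => by
      rw [mem_evenFunctions] at hf ⊢
      rw [← hf]
      exact Equiv.sum_comp σ.symm f)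
    (by
      rw [mem_evenFunctions]
      simp [Finset.sum_add_distrib, CharTwo.add_self_eq_zero])
    (fun B => evenFunctions_le hconn B)
  let T : Finset (Perm (X × ZMod 2)) :=
    insert (fiberShift (Pi.single u 1 + Pi.single v 1)) (S.image liftFst)
  have hT : (T : Set (Perm (X × ZMod 2))) =
      insert (fiberShift (Pi.single u 1 + Pi.single v 1)) (liftFst '' (S : Set (Perm X))) := by
    simp [T]
  have hTcard : T.card ≤ m + 1 :=
    (Finset.card_insert_le _ _).trans (Nat.succ_le_succ (Finset.card_image_le.trans hS))
  have hTsign : ∀ π ∈ T, Perm.sign π = 1 := by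
    simp only [T, Finset.mem_insert, Finset.mem_image]
    rintro _ (rfl | ⟨σ, -, rfl⟩)
    · exact sign_fiberShift_single_add_single u v
    · exact sign_liftFst σ
  have hcardX : Fintype.card (X × ZMod 2) = Fintype.card (Fin (2 ^ (m + 1))) := by
    simp [hX, pow_succ]
  let e : Perm (X × ZMod 2) ≃* Perm (Fin (2 ^ (m + 1))) :=
    (Fintype.equivOfCardEq hcardX).permCongrHom
  let L := (Subgroup.closure (T : Set (Perm (X × ZMod 2)))).map e.toMonoidHom
  have hL : L ≤ alternatingGroup (Fin (2 ^ (m + 1))) := by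
    rw [Subgroup.map_le_iff_le_comap, Subgroup.closure_le]
    intro π hπ
    exact (Perm.sign_permCongr _ π).trans (hTsign π hπ)
  let ε : Subgroup.closure (T : Set (Perm (X × ZMod 2))) ≃*
      L.subgroupOf (alternatingGroup (Fin (2 ^ (m + 1)))) :=
    (e.subgroupMap _).trans (Subgroup.subgroupOfEquivOfLe hL).symm
  refine ⟨L.subgroupOf _, ?_, ?_⟩
  · have hne : Nonempty X := ⟨u⟩
    have h := card_evenFunctions_mul_two (X := X)
    rw [← Nat.card_congr ε.toEquiv, hT, hcl, hcard]
    have h1 := Nat.one_le_two_pow (n := m)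
    have h2 : Nat.card (evenFunctions X) = 2 ^ (2 ^ m - 1) := by
      apply Nat.eq_of_mul_eq_mul_right two_pos
      rw [h, hX, ← pow_succ, Nat.sub_add_cancel h1]
    rw [h2, ← pow_add]
    congr 1
    rw [pow_succ]
    omega
  · rw [← Group.rank_congr ε]
    exact (Subgroup.rank_closure_finset_le_card T).trans hTcard

/-- For `k ≥ 1`, any Sylow 2-subgroup of `A_{2^k}` admits a generating set of
cardinality `k`. -/
theorem stmt_7 (k : ℕ) (hk : 1 ≤ k) (P : Sylow 2 (alternatingGroup (Fin (2 ^ k)))) :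
    ∃ S : Finset P, S.card = k ∧ Subgroup.closure (S : Set P) = ⊤ := by
  obtain ⟨K, hK, hrank⟩ := exists_subgroup_alternatingGroup_rank_le hk
  have := Fintype.ofFinite P
  let Q : Sylow 2 (alternatingGroup (Fin (2 ^ k))) :=
    Sylow.ofCard K (by rw [hK, factorization_two_card_alternatingGroup hk])
  have hPQ : Group.rank P = Group.rank K := Group.rank_congr (P.equiv Q)
  have hPcard : k ≤ Fintype.card P := by
    rw [← Nat.card_eq_fintype_card, P.card_eq_multiplicity,
      factorization_two_card_alternatingGroup hk]
    have h1 := Nat.lt_two_pow_self (n := k)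
    have h2 := Nat.lt_two_pow_self (n := 2 ^ k - 2)
    omega
  obtain ⟨S, hS, hgen⟩ := Group.rank_spec P
  obtain ⟨T, hST, hT⟩ := Finset.exists_superset_card_eq (s := S) (by omega) hPcard
  exact ⟨T, hT, top_le_iff.mp (hgen.symm.le.trans (Subgroup.closure_mono (by exact_mod_cast hST)))⟩
end

section
/- For every k ≥ 2, the minimal number of generators of any Sylow 2-subgroup P of the alternating group A_{2^k} equals k: there is a generating set of P with k elements and every generating set of P has at least k elements (i.e. Group.rank P = k). -/
open Equiv.Perm

namespace RegularWreathProduct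

variable {D Q A : Type*} [Group D] [Group Q] [CommGroup A]

/-- The homomorphism `⟨l, r⟩ ↦ ∏ q, g (l q)` induced on a wreath product by a homomorphism `g`
from the base group to a commutative group. -/
def prodHom [Fintype Q] (g : D →* A) : D ≀ᵣ Q →* A where
  toFun x := ∏ q, g (x.left q)
  map_one' := by simp
  map_mul' x y := by
    simp only [mul_left, Pi.mul_apply, map_mul, Finset.prod_mul_distrib]
    congr 1
    exact Fintype.prod_equiv (Equiv.mulLeft x.right⁻¹) _ _ fun _ ↦ rfl

lemma prodHom_apply [Fintype Q] (g : D →* A) (x : D ≀ᵣ Q) :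
    prodHom g x = ∏ q, g (x.left q) := rfl

lemma prodHom_apply_units (g : D →* A) (x : D ≀ᵣ ℤˣ) :
    prodHom g x = g (x.left 1) * g (x.left (-1)) := by
  rw [prodHom_apply, show (Finset.univ : Finset ℤˣ) = {1, -1} by decide,
    Finset.prod_pair (by decide)]

/-- The embedding of the base group in the coordinate at `1`. -/
def single [DecidableEq Q] : D →* D ≀ᵣ Q where
  toFun d := ⟨Pi.mulSingle 1 d, 1⟩
  map_one' := by ext <;> simp
  map_mul' x y := by ext <;> simp [Pi.mulSingle_mul]

lemma left_single [DecidableEq Q] (d : D) : (single d : D ≀ᵣ Q).left = Pi.mulSingle 1 d := rfl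

lemma right_single [DecidableEq Q] (d : D) : (single d : D ≀ᵣ Q).right = 1 := rfl

/-- The diagonal embedding of the base group. -/
def diagonal : D →* D ≀ᵣ Q where
  toFun d := ⟨fun _ ↦ d, 1⟩
  map_one' := by ext <;> simp
  map_mul' x y := by ext <;> simp

lemma left_diagonal (d : D) (q : Q) : (diagonal d : D ≀ᵣ Q).left q = d := rfl

lemma right_diagonal (d : D) : (diagonal d : D ≀ᵣ Q).right = 1 := rfl

lemma prodHom_single_units (g : D →* A) (d : D) : prodHom g (single d : D ≀ᵣ ℤˣ) = g d := by
  simp [prodHom_apply_units, left_single, Pi.mulSingle]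

lemma diagonal_conj_single [DecidableEq Q] (d w : D) :
    (diagonal w * single d * diagonal w⁻¹ : D ≀ᵣ Q) = single (w * d * w⁻¹) := by
  ext q
  · by_cases hq : q = 1 <;> simp [left_single, left_diagonal, right_diagonal, right_single,
      Pi.mulSingle, Function.update, hq]
  · simp [right_diagonal, right_single]

lemma eq_single_mul_inl_mul_single_mul_inl (x : D ≀ᵣ ℤˣ) :
    x = single (x.left 1) * inl (-1) * single (x.left (-1)) * inl (-1) * inl x.right := by
  ext q
  · rcases Int.units_eq_one_or q with rfl | rfl <;>
      simp [left_single, right_single, Pi.mulSingle]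
  · simp [right_single]

lemma mem_of_single_mem {H : Subgroup (D ≀ᵣ ℤˣ)} (hH : inl (-1) ∈ H) {x : D ≀ᵣ ℤˣ}
    (h₁ : single (x.left 1) ∈ H) (h₂ : single (x.left (-1)) ∈ H) : x ∈ H := by
  rw [eq_single_mul_inl_mul_single_mul_inl x]
  have hr : inl x.right ∈ H := by
    rcases Int.units_eq_one_or x.right with h | h <;> rw [h]
    · rw [map_one]
      exact one_mem H
    · exact hH
  exact mul_mem (mul_mem (mul_mem (mul_mem h₁ hH) h₂) hH) hr

end RegularWreathProduct

open RegularWreathProduct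

/-- A group with a sign homomorphism that is generated by `m` even elements together with an odd
involution, and that has, independently of the sign, an elementary abelian quotient of
order `2 ^ m`. -/
structure HasSignedRank {D : Type*} [Group D] (s : D →* ℤˣ) (m : ℕ) : Prop where
  exists_generators : ∃ (T : Finset D) (w : D), T.card ≤ m ∧ (∀ t ∈ T, s t = 1) ∧ w * w = 1 ∧
    s w = -1 ∧ Subgroup.closure (insert w (T : Set D)) = ⊤
  exists_quotient : ∃ (V : Type) (_ : CommGroup V) (φ : D →* V), Nat.card V = 2 ^ m ∧
    (∀ v : V, v ^ 2 = 1) ∧ Function.Surjective (φ.prod s)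

namespace HasSignedRank

variable {D : Type*} [Group D] {s : D →* ℤˣ} {m : ℕ}

lemma surjective (h : HasSignedRank s m) : Function.Surjective s := by
  obtain ⟨V, _, φ, -, -, hφ⟩ := h.exists_quotient
  intro e
  obtain ⟨d, hd⟩ := hφ (1, e)
  exact ⟨d, congrArg Prod.snd hd⟩

lemma id_units : HasSignedRank (MonoidHom.id ℤˣ) 0 where
  exists_generators := by
    refine ⟨∅, -1, le_rfl, by simp, by simp, rfl, ?_⟩
    rw [eq_top_iff]
    rintro x -
    rcases Int.units_eq_one_or x with rfl | rfl
    · exact one_mem _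
    · exact Subgroup.subset_closure (by simp)
  exists_quotient := ⟨Unit, inferInstance, 1, by simp, fun _ ↦ rfl, fun x ↦ ⟨x.2, rfl⟩⟩

lemma prodHom (h : HasSignedRank s m) :
    HasSignedRank (prodHom s : D ≀ᵣ ℤˣ →* ℤˣ) (m + 1) where
  exists_generators := by
    classical
    obtain ⟨T, w, hT, hsT, hw, hsw, hgen⟩ := h.exists_generators
    refine ⟨insert (inl (-1)) (T.image single), single w, ?_, ?_, ?_, ?_, ?_⟩
    · exact (Finset.card_insert_le _ _).trans (by gcongr; exact Finset.card_image_le.trans hT)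
    · intro t ht
      rcases Finset.mem_insert.mp ht with rfl | ht
      · simp [prodHom_apply_units]
      · obtain ⟨t, htT, rfl⟩ := Finset.mem_image.mp ht
        rw [prodHom_single_units, hsT t htT]
    · rw [← map_mul, hw, map_one]
    · rw [prodHom_single_units, hsw]
    · set H := Subgroup.closure (insert (single w)
        ((insert (inl (-1)) (T.image single) : Finset (D ≀ᵣ ℤˣ)) : Set (D ≀ᵣ ℤˣ))) with hH
      have hD : ∀ d : D, (single d : D ≀ᵣ ℤˣ) ∈ H := by
        have : (⊤ : Subgroup D) ≤ H.comap single := by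
          rw [← hgen, Subgroup.closure_le]
          rintro t (rfl | ht)
          · exact Subgroup.subset_closure (by simp)
          · refine Subgroup.subset_closure (Or.inr ?_)
            exact Finset.mem_insert_of_mem (Finset.mem_image_of_mem _ ht)
        exact fun d ↦ this (Subgroup.mem_top d)
      rw [eq_top_iff]
      rintro x -
      exact mem_of_single_mem (Subgroup.subset_closure (by simp)) (hD _) (hD _)
  exists_quotient := by
    obtain ⟨V, _, φ, hV, hexp, hφ⟩ := h.exists_quotient
    refine ⟨V × ℤˣ, inferInstance, (RegularWreathProduct.prodHom φ).prod rightHom, ?_, ?_, ?_⟩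
    · simp [hV, pow_succ]
    · rintro ⟨v, e⟩
      simp [hexp]
    · rintro ⟨⟨v, r⟩, e⟩
      obtain ⟨d, hd⟩ := hφ (v, e)
      refine ⟨⟨Pi.mulSingle 1 d, r⟩, ?_⟩
      simp only [MonoidHom.prod_apply, Prod.mk.injEq] at hd
      simp [prodHom_apply_units, hd.1, hd.2, Pi.mulSingle]

lemma rank_ker_prodHom_le [Finite D] (h : HasSignedRank s m) :
    Group.rank (RegularWreathProduct.prodHom s : D ≀ᵣ ℤˣ →* ℤˣ).ker ≤ m + 2 := by
  classical
  obtain ⟨T, w, hT, hsT, hw, hsw, hgen⟩ := h.exists_generators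
  set K := (RegularWreathProduct.prodHom s : D ≀ᵣ ℤˣ →* ℤˣ).ker with hK
  set S : Finset (D ≀ᵣ ℤˣ) := insert (inl (-1)) (insert (diagonal w) (T.image single)) with hS
  set H := Subgroup.closure (S : Set (D ≀ᵣ ℤˣ)) with hH
  have hσ : inl (-1) ∈ H := Subgroup.subset_closure (by simp [hS])
  have hω : diagonal w ∈ H := Subgroup.subset_closure (by simp [hS])
  have hwinv : w⁻¹ = w := inv_eq_of_mul_eq_one_left hw
  have hHK : H ≤ K := by
    rw [hH, Subgroup.closure_le]
    intro t ht
    simp only [hS, Finset.coe_insert, Finset.coe_image, Set.mem_insert_iff, Set.mem_image,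
      Finset.mem_coe] at ht
    rcases ht with rfl | rfl | ⟨t, ht, rfl⟩
    · simp [hK, prodHom_apply_units]
    · simp [hK, prodHom_apply_units, left_diagonal, hsw]
    · simp [hK, MonoidHom.mem_ker, prodHom_single_units, hsT t ht]
  have hTH : ∀ t ∈ T, (single t : D ≀ᵣ ℤˣ) ∈ H := fun t ht ↦ Subgroup.subset_closure (by
    rw [hS]
    exact Finset.mem_insert_of_mem
      (Finset.mem_insert_of_mem (Finset.mem_image_of_mem single ht)))
  have hconj : ∀ d : D, (single d : D ≀ᵣ ℤˣ) ∈ H → (single (w * d * w) : D ≀ᵣ ℤˣ) ∈ H := by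
    intro d hd
    have := mul_mem (mul_mem hω hd) (inv_mem hω)
    rwa [← map_inv, diagonal_conj_single, hwinv] at this
  have hstep : ∀ d t : D, (single t : D ≀ᵣ ℤˣ) ∈ H →
      (single d : D ≀ᵣ ℤˣ) ∈ H ∨ (single (d * w) : D ≀ᵣ ℤˣ) ∈ H →
      (single (d * t) : D ≀ᵣ ℤˣ) ∈ H ∨ (single (d * t * w) : D ≀ᵣ ℤˣ) ∈ H := by
    rintro d t ht (hd | hd)
    · left
      rw [map_mul]
      exact mul_mem hd ht
    · right
      have : d * t * w = d * w * (w * t * w) := by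
        calc d * t * w = d * (w * w) * t * w := by rw [hw, mul_one]
          _ = d * w * (w * t * w) := by group
      rw [this, map_mul]
      exact mul_mem hd (hconj t ht)
  have hwstep : ∀ d : D,
      (single d : D ≀ᵣ ℤˣ) ∈ H ∨ (single (d * w) : D ≀ᵣ ℤˣ) ∈ H →
      (single (d * w) : D ≀ᵣ ℤˣ) ∈ H ∨ (single (d * w * w) : D ≀ᵣ ℤˣ) ∈ H := by
    intro d hd
    rw [mul_assoc d w w, hw, mul_one]
    exact hd.symm
  have hall : ∀ d : D, (single d : D ≀ᵣ ℤˣ) ∈ H ∨ (single (d * w) : D ≀ᵣ ℤˣ) ∈ H := by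
    intro d
    have hd : d ∈ Subgroup.closure (insert w (T : Set D)) := hgen ▸ Subgroup.mem_top d
    induction hd using Subgroup.closure_induction_right with
    | one => exact Or.inl (by rw [map_one]; exact one_mem H)
    | mul_right x _ y hy ih =>
      rcases hy with rfl | hy
      · exact hwstep x ih
      · exact hstep x y (hTH y hy) ih
    | mul_inv_cancel x _ y hy ih =>
      rcases hy with rfl | hy
      · rw [hwinv]
        exact hwstep x ih
      · exact hstep x y⁻¹ (by rw [map_inv]; exact inv_mem (hTH y hy)) ih
  have heven : ∀ d : D, s d = 1 → (single d : D ≀ᵣ ℤˣ) ∈ H := by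
    intro d hd
    refine (hall d).resolve_right fun hdw ↦ ?_
    have := MonoidHom.mem_ker.mp (hHK hdw)
    rw [prodHom_single_units, map_mul, hd, hsw] at this
    exact absurd this (by decide)
  have hKH : K ≤ H := by
    intro x hx
    rw [hK, MonoidHom.mem_ker, prodHom_apply_units] at hx
    rcases Int.units_eq_one_or (s (x.left 1)) with h₁ | h₁
    · rw [h₁, one_mul] at hx
      exact mem_of_single_mem hσ (heven _ h₁) (heven _ hx)
    · have h₂ : s (x.left (-1)) = -1 := by
        rw [h₁, neg_one_mul] at hx
        exact neg_eq_iff_eq_neg.mp hx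
      have : diagonal w * x ∈ H := by
        refine mem_of_single_mem hσ (heven _ ?_) (heven _ ?_) <;>
          simp [left_diagonal, right_diagonal, hsw, h₁, h₂]
      exact (Subgroup.mul_mem_cancel_left H hω).mp this
  rw [Subgroup.rank_congr (le_antisymm hKH hHK)]
  refine (Subgroup.rank_closure_finset_le_card S).trans ?_
  have h₁ := Finset.card_insert_le (inl (-1) : D ≀ᵣ ℤˣ) (insert (diagonal w) (T.image single))
  have h₂ := Finset.card_insert_le (diagonal w : D ≀ᵣ ℤˣ) (T.image single)
  have h₃ := Finset.card_image_le (s := T) (f := (single : D →* D ≀ᵣ ℤˣ))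
  rw [← hS] at h₁
  omega

/-- On the kernel of `prodHom s`, the sign of either coordinate is a homomorphism. -/
def coordSign (s : D →* ℤˣ) : (RegularWreathProduct.prodHom s : D ≀ᵣ ℤˣ →* ℤˣ).ker →* ℤˣ where
  toFun x := s (x.1.left 1)
  map_one' := by simp
  map_mul' x y := by
    have hy := MonoidHom.mem_ker.mp y.2
    rw [prodHom_apply_units, mul_eq_one_iff_eq_inv, Int.units_inv_eq_self] at hy
    rcases Int.units_eq_one_or x.1.right with h | h <;> simp [h, hy]

lemma le_rank_ker_prodHom [Finite D] (h : HasSignedRank s m) :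
    m + 2 ≤ Group.rank (RegularWreathProduct.prodHom s : D ≀ᵣ ℤˣ →* ℤˣ).ker := by
  obtain ⟨V, _, φ, hV, hexp, hφ⟩ := h.exists_quotient
  have : Finite V := Nat.finite_of_card_ne_zero (by simp [hV])
  let ψ : (RegularWreathProduct.prodHom s : D ≀ᵣ ℤˣ →* ℤˣ).ker →* V × ℤˣ × ℤˣ :=
    (((RegularWreathProduct.prodHom φ).prod rightHom).comp (Subgroup.subtype _)).prod
      (coordSign s) |> MulEquiv.prodAssoc.toMonoidHom.comp
  have hψ : Function.Surjective ψ := by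
    rintro ⟨v, r, e⟩
    obtain ⟨d₁, hd₁⟩ := hφ (v, e)
    obtain ⟨d₂, hd₂⟩ := hφ (1, e)
    simp only [MonoidHom.prod_apply, Prod.mk.injEq] at hd₁ hd₂
    refine ⟨⟨⟨fun q ↦ if q = 1 then d₁ else d₂, r⟩, ?_⟩, ?_⟩
    · simp [MonoidHom.mem_ker, prodHom_apply_units, hd₁.2, hd₂.2]
    · simp [ψ, MulEquiv.prodAssoc, coordSign, prodHom_apply_units, hd₁, hd₂.1]
  have hcard := card_dvd_exponent_pow_rank' (V × ℤˣ × ℤˣ) (n := 2) (by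
    rintro ⟨v, r, e⟩
    simp [hexp])
  have hV' : Nat.card (V × ℤˣ × ℤˣ) = 2 ^ (m + 2) := by
    simp [hV, pow_add]
  rw [hV', Nat.pow_dvd_pow_iff_le_right (by norm_num)] at hcard
  exact hcard.trans (Group.rank_le_of_surjective ψ hψ)

lemma rank_ker_prodHom [Finite D] (h : HasSignedRank s m) :
    Group.rank (RegularWreathProduct.prodHom s : D ≀ᵣ ℤˣ →* ℤˣ).ker = m + 2 :=
  le_antisymm h.rank_ker_prodHom_le h.le_rank_ker_prodHom

end HasSignedRank

section Action

variable (D Λ : Type*) [Group D] [Fintype Λ] [DecidableEq Λ] [MulAction D Λ]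

/-- The sign of the permutation by which a group element acts. -/
def actionSign : D →* ℤˣ := sign.comp (MulAction.toPermHom D Λ)

lemma actionSign_wreath {Q : Type*} [Group Q] [Fintype Q] [DecidableEq Q]
    (hΛ : Even (Fintype.card Λ)) : actionSign (D ≀ᵣ Q) (Λ × Q) = prodHom (actionSign D Λ) := by
  ext1 x
  have key : MulAction.toPermHom (D ≀ᵣ Q) (Λ × Q) x =
      Equiv.prodCongrLeft (fun q ↦ MulAction.toPermHom D Λ (x.left q)) *
        Equiv.prodCongrRight (fun _ : Λ ↦ Equiv.mulLeft x.right) := by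
    ext1 ⟨a, q⟩
    simp
  rw [actionSign, MonoidHom.comp_apply, key, map_mul, sign_prodCongrLeft, sign_prodCongrRight,
    Finset.prod_const, Finset.card_univ]
  have : sign (Equiv.mulLeft x.right) ^ Fintype.card Λ = 1 := by
    obtain ⟨c, hc⟩ := hΛ
    rw [hc, ← two_mul, pow_mul, Int.units_sq, one_pow]
  rw [this, mul_one]
  rfl

/-- A faithful action on `2 ^ (n + 1)` points of a group having the order of a Sylow `2`-subgroup
of the symmetric group, such that the sign homomorphism satisfies `HasSignedRank`. -/
structure IsBinaryTreeAction (n : ℕ) : Prop where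
  card_group : Nat.card D = 2 ^ (2 ^ (n + 1) - 1)
  card_points : Fintype.card Λ = 2 ^ (n + 1)
  faithful : FaithfulSMul D Λ
  hasSignedRank : HasSignedRank (actionSign D Λ) n

lemma IsBinaryTreeAction.wreath {D Λ : Type*} [Group D] [Fintype Λ] [DecidableEq Λ]
    [MulAction D Λ] {n : ℕ} (h : IsBinaryTreeAction D Λ n) :
    IsBinaryTreeAction (D ≀ᵣ ℤˣ) (Λ × ℤˣ) (n + 1) where
  card_group := by
    have : 1 ≤ 2 ^ (n + 1) := Nat.one_le_two_pow
    rw [RegularWreathProduct.card, h.card_group, Nat.card_eq_fintype_card, Fintype.card_units_int,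
      ← pow_mul, ← pow_succ]
    congr 1
    rw [pow_succ 2 (n + 1)]
    omega
  card_points := by
    rw [Fintype.card_prod, h.card_points, Fintype.card_units_int, ← pow_succ]
  faithful := by
    have := h.faithful
    have : Nonempty Λ := Fintype.card_pos_iff.mp (by rw [h.card_points]; positivity)
    infer_instance
  hasSignedRank := by
    rw [actionSign_wreath D Λ (by rw [h.card_points, pow_succ]; exact even_two.mul_left _)]
    exact h.hasSignedRank.prodHom

lemma isBinaryTreeAction_units : IsBinaryTreeAction ℤˣ ℤˣ 0 where
  card_group := by simp
  card_points := by simp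
  faithful := inferInstance
  hasSignedRank := by
    have : actionSign ℤˣ ℤˣ = MonoidHom.id ℤˣ := by
      ext1 x
      rcases Int.units_eq_one_or x with rfl | rfl
      · simp
      · decide
    exact this ▸ HasSignedRank.id_units

lemma exists_isBinaryTreeAction (n : ℕ) :
    ∃ (D Λ : Type) (_ : Group D) (_ : Fintype Λ) (_ : DecidableEq Λ) (_ : MulAction D Λ),
      IsBinaryTreeAction D Λ n := by
  induction n with
  | zero => exact ⟨_, _, _, _, _, _, isBinaryTreeAction_units⟩
  | succ n ih =>
    obtain ⟨D, Λ, _, _, _, _, h⟩ := ih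
    exact ⟨_, _, _, _, _, _, h.wreath⟩

end Action

lemma card_alternatingGroup_factorization_two (k : ℕ) (hk : 1 ≤ k) :
    (Nat.card (alternatingGroup (Fin (2 ^ k)))).factorization 2 = 2 ^ k - 2 := by
  have : Nontrivial (Fin (2 ^ k)) :=
    Fin.nontrivial_iff_two_le.mpr (Nat.pow_le_pow_right two_pos hk)
  have h := two_mul_nat_card_alternatingGroup (α := Fin (2 ^ k))
  have h' := congrArg (fun n ↦ n.factorization 2) h
  have hcard : (Nat.card (Equiv.Perm (Fin (2 ^ k)))).factorization 2 = 2 ^ k - 1 := by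
    rw [Nat.card_perm, Nat.card_fin,
      ← Nat.multiplicity_eq_factorization Nat.prime_two (2 ^ k).factorial_ne_zero,
      Nat.prime_two.multiplicity_factorial_pow, Nat.geomSum_eq le_rfl]
    simp
  simp only [hcard] at h'
  rw [Nat.factorization_mul two_ne_zero Nat.card_pos.ne', Finsupp.add_apply,
    Nat.prime_two.factorization_self] at h'
  omega

/-- A Sylow `2`-subgroup of `A_{2 ^ k}` is isomorphic to any group of the same order that acts
faithfully by even permutations on `2 ^ k` points. -/
lemma Sylow.nonempty_mulEquiv_of_alternatingGroup {k : ℕ} (hk : 1 ≤ k)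
    (P : Sylow 2 (alternatingGroup (Fin (2 ^ k)))) {G Λ : Type*} [Group G] [Fintype Λ]
    [DecidableEq Λ] (hΛ : Fintype.card Λ = 2 ^ k) (f : G →* Equiv.Perm Λ)
    (hf : Function.Injective f) (hsign : ∀ g, sign (f g) = 1)
    (hG : Nat.card G = 2 ^ (2 ^ k - 2)) : Nonempty (P ≃* G) := by
  let e := Fintype.equivFinOfCardEq hΛ
  let F : G →* alternatingGroup (Fin (2 ^ k)) :=
    (e.permCongrHom.toMonoidHom.comp f).codRestrict _ fun g ↦ by
      simp [mem_alternatingGroup, hsign]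
  have hF : Function.Injective F := fun a b hab ↦
    hf (e.permCongrHom.injective (congrArg Subtype.val hab))
  let g := MonoidHom.ofInjective hF
  let R : Sylow 2 (alternatingGroup (Fin (2 ^ k))) := Sylow.ofCard F.range (by
    rw [← Nat.card_congr g.toEquiv, hG, card_alternatingGroup_factorization_two k hk])
  exact ⟨(P.equiv R).trans g.symm⟩

lemma Sylow.rank_alternatingGroup_two_pow (k : ℕ) (hk : 2 ≤ k)
    (P : Sylow 2 (alternatingGroup (Fin (2 ^ k)))) : Group.rank P = k := by
  obtain ⟨n, rfl⟩ := Nat.exists_eq_add_of_le' hk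
  obtain ⟨D, Λ, _, _, _, _, h⟩ := exists_isBinaryTreeAction n
  have : Finite D := Nat.finite_of_card_ne_zero (by simp [h.card_group])
  have hw := h.wreath
  have hs : actionSign (D ≀ᵣ ℤˣ) (Λ × ℤˣ) = prodHom (actionSign D Λ) :=
    actionSign_wreath D Λ (by rw [h.card_points, pow_succ]; exact even_two.mul_left _)
  have := hw.faithful
  obtain ⟨e⟩ := P.nonempty_mulEquiv_of_alternatingGroup (by omega) hw.card_points
    (G := (prodHom (actionSign D Λ) : D ≀ᵣ ℤˣ →* ℤˣ).ker)
    ((MulAction.toPermHom _ _).comp (Subgroup.subtype _))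
    (MulAction.toPerm_injective.comp Subtype.val_injective)
    (fun g ↦ (DFunLike.congr_fun hs g.1).trans (MonoidHom.mem_ker.mp g.2))
    (by
      have hi := Subgroup.card_mul_index (prodHom (actionSign D Λ) : D ≀ᵣ ℤˣ →* ℤˣ).ker
      rw [Subgroup.index_ker, MonoidHom.range_eq_top.mpr (hs ▸ hw.hasSignedRank.surjective),
        Subgroup.card_top, Nat.card_eq_fintype_card (α := ℤˣ), Fintype.card_units_int,
        hw.card_group] at hi
      have h2 : 2 ^ (n + 1 + 1) - 1 = 2 ^ (n + 2) - 2 + 1 := by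
        have : 1 ≤ 2 ^ n := Nat.one_le_two_pow
        rw [show n + 1 + 1 = n + 2 from rfl, pow_add]
        omega
      rw [h2, pow_succ] at hi
      exact Nat.eq_of_mul_eq_mul_right two_pos hi)
  rw [Group.rank_congr e, h.hasSignedRank.rank_ker_prodHom]


/-- For `k ≥ 2`, the minimal number of generators of a Sylow 2-subgroup `P` of
`A_{2^k}` is exactly `k`: there is a generating set with `k` elements, every
generating set has at least `k` elements, and `Group.rank P = k`. -/
theorem stmt_8 (k : ℕ) (hk : 2 ≤ k) (P : Sylow 2 (alternatingGroup (Fin (2 ^ k)))) :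
    (∃ S : Finset P, S.card = k ∧ Subgroup.closure (S : Set P) = ⊤) ∧
    (∀ S : Finset P, Subgroup.closure (S : Set P) = ⊤ → k ≤ S.card) ∧
    Group.rank P = k := by
  have h := P.rank_alternatingGroup_two_pow k hk
  refine ⟨?_, fun S hS ↦ h.ge.trans (Group.rank_le hS), h⟩
  obtain ⟨S, hcard, hS⟩ := Group.rank_spec P
  exact ⟨S, hcard.trans h, hS⟩
end

section
/- For every k ≥ 2, if P is a Sylow 2-subgroup of the alternating group A_{2^k} and Φ(P) is its Frattini subgroup, then the quotient group P/Φ(P) is isomorphic to the elementary abelian group (ZMod 2)^k (the direct product of k copies of the cyclic group of order 2); in particular |P/Φ(P)| = 2^k. -/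
/-- In a finite `2`-group, a maximal subgroup is the kernel of a character with values in `ℤˣ`. -/
theorem IsPGroup.exists_ker_eq_of_isCoatom {G : Type*} [Group G] [Finite G] (hG : IsPGroup 2 G)
    {M : Subgroup G} (hM : IsCoatom M) : ∃ χ : G →* ℤˣ, χ.ker = M := by
  have hidx : M.index = 2 := by
    obtain ⟨m, hm⟩ := IsPGroup.iff_card.mp (hG.to_subgroup M)
    obtain ⟨n, hn⟩ := IsPGroup.iff_card.mp hG
    have hlt : m < n := by
      refine lt_of_le_of_ne ?_ ?_
      · have := M.card_subgroup_dvd_card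
        rw [hm, hn] at this
        exact (Nat.pow_dvd_pow_iff_le_right one_lt_two).mp this
      · rintro rfl
        exact hM.1 (Subgroup.eq_top_of_card_eq M (by rw [hm, hn]))
    obtain ⟨K, hK, hMK⟩ := Sylow.exists_subgroup_card_pow_succ (p := 2)
      (by rw [hn]; exact pow_dvd_pow 2 hlt) hm
    have hKtop : K = ⊤ := by
      refine hM.2 K (lt_of_le_of_ne hMK ?_)
      rintro rfl
      have := Nat.pow_right_injective le_rfl (hm.symm.trans hK)
      omega
    have hcard := M.card_mul_index
    rw [← Subgroup.card_top (G := G), ← hKtop, hK, hm, pow_succ] at hcard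
    exact Nat.eq_of_mul_eq_mul_left (by positivity) hcard
  classical
  refine ⟨MonoidHom.mk' (fun g => if g ∈ M then 1 else -1) fun a b => ?_, ?_⟩
  · have := Subgroup.mul_mem_iff_of_index_two hidx (a := a) (b := b)
    by_cases ha : a ∈ M <;> by_cases hb : b ∈ M <;> simp_all
  · ext g
    by_cases hg : g ∈ M <;> simp [MonoidHom.mem_ker, hg]

/-- The kernel of a character with values in `ℤˣ` contains the Frattini subgroup. -/
theorem frattini_le_ker_of_units_int {G : Type*} [Group G] (χ : G →* ℤˣ) :
    frattini G ≤ χ.ker := by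
  by_cases h : χ = 1
  · simp [h]
  have hsurj : Function.Surjective χ := by
    have : ∃ g, χ g ≠ 1 := by
      by_contra! hc
      exact h (MonoidHom.ext hc)
    obtain ⟨g, hg⟩ := this
    intro y
    rcases Int.units_eq_one_or y with rfl | rfl
    · exact ⟨1, map_one χ⟩
    · exact ⟨g, (Int.units_eq_one_or _).resolve_left hg⟩
  have : IsSimpleGroup ℤˣ := isSimpleGroup_of_prime_card (p := 2) (by simp)
  exact frattini_le_coatom (Subgroup.isCoatom_comap_of_surjective hsurj isCoatom_bot)

/-- If characters `φ i` are dual to elements `γ i` of a finite `2`-group, and a character vanishing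
on all `γ i` is trivial, then the Frattini subgroup is the common kernel of the `φ i`. -/
theorem IsPGroup.frattini_eq_ker {G : Type*} [Group G] [Finite G] (hG : IsPGroup 2 G)
    {ι : Type*} [Fintype ι] [DecidableEq ι] (φ : G →* (ι → ℤˣ)) (γ : ι → G)
    (hφ : ∀ i, φ (γ i) = Pi.mulSingle i (-1))
    (hγ : ∀ χ : G →* ℤˣ, (∀ i, χ (γ i) = 1) → χ = 1) :
    frattini G = φ.ker := by
  apply le_antisymm
  · intro x hx
    rw [MonoidHom.mem_ker]
    ext1 i
    exact frattini_le_ker_of_units_int ((Pi.evalMonoidHom _ i).comp φ) hx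
  · refine le_iInf₂ fun M hM => ?_
    obtain ⟨χ, rfl⟩ := hG.exists_ker_eq_of_isCoatom hM
    let s : ι → (ℤˣ →* ℤˣ) := fun i => if χ (γ i) = 1 then 1 else MonoidHom.id _
    have hs : ∀ i, s i (-1) = χ (γ i) := by
      intro i
      rcases Int.units_eq_one_or (χ (γ i)) with h | h <;> simp [s, h]
    let ρ : G →* ℤˣ := ∏ i, (s i).comp ((Pi.evalMonoidHom _ i).comp φ)
    have hρ : ∀ g, ρ g = ∏ i, s i (φ g i) := fun g => by simp [ρ, MonoidHom.finsetProd_apply]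
    have : χ = ρ := by
      rw [← div_eq_one]
      apply hγ
      intro i
      rw [MonoidHom.div_apply, hρ, hφ, Finset.prod_eq_single i, Pi.mulSingle_eq_same, hs, div_self']
      · intro j _ hj
        rw [Pi.mulSingle_eq_of_ne hj, map_one]
      · simp
    intro g hg
    rw [MonoidHom.mem_ker] at hg ⊢
    rw [this, hρ, hg]
    simp

/-- Under the hypotheses of `IsPGroup.frattini_eq_ker`, the Frattini quotient is a power of `ℤˣ`. -/
theorem IsPGroup.nonempty_quotient_frattini_mulEquiv {G : Type*} [Group G] [Finite G]
    (hG : IsPGroup 2 G) {ι : Type*} [Fintype ι] [DecidableEq ι] (φ : G →* (ι → ℤˣ)) (γ : ι → G)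
    (hφ : ∀ i, φ (γ i) = Pi.mulSingle i (-1))
    (hγ : ∀ χ : G →* ℤˣ, (∀ i, χ (γ i) = 1) → χ = 1) :
    Nonempty (G ⧸ frattini G ≃* (ι → ℤˣ)) := by
  have hsurj : Function.Surjective φ := by
    rw [← MonoidHom.range_eq_top, eq_top_iff]
    intro y _
    rw [← Finset.univ_prod_mulSingle y]
    refine Subgroup.prod_mem _ fun i _ => ?_
    rcases Int.units_eq_one_or (y i) with h | h
    · rw [h, Pi.mulSingle_one]
      exact one_mem _
    · exact ⟨γ i, by rw [h, hφ]⟩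
  exact ⟨(QuotientGroup.quotientMulEquivOfEq (hG.frattini_eq_ker φ γ hφ hγ)).trans
    (QuotientGroup.quotientKerEquivOfSurjective φ hsurj)⟩

/-- Isomorphic groups have isomorphic Frattini quotients. -/
theorem nonempty_quotient_frattini_congr {G H : Type*} [Group G] [Group H] (e : G ≃* H) :
    Nonempty (G ⧸ frattini G ≃* H ⧸ frattini H) := by
  refine ⟨QuotientGroup.congr _ _ e (le_antisymm ?_ ?_)⟩
  · exact Subgroup.map_le_iff_le_comap.mpr (frattini_le_comap_frattini_of_surjective
      (φ := e.toMonoidHom) e.surjective)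
  · intro x hx
    exact ⟨e.symm x, frattini_le_comap_frattini_of_surjective
      (φ := e.symm.toMonoidHom) e.symm.surjective hx, by simp⟩

/-- The group of automorphisms of the complete rooted binary tree of height `n`. -/
def BinaryTreeAut (n : ℕ) : Type := IteratedWreathProduct ℤˣ n

namespace BinaryTreeAut

instance (n : ℕ) : Group (BinaryTreeAut n) := inferInstanceAs (Group (IteratedWreathProduct ℤˣ n))

instance (n : ℕ) : Finite (BinaryTreeAut n) := inferInstanceAs (Finite (IteratedWreathProduct ℤˣ n))

instance : Subsingleton (BinaryTreeAut 0) := inferInstanceAs (Subsingleton PUnit)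

/-- The automorphism with prescribed restrictions to the two halves of the tree, followed by the
prescribed action on the set of halves. -/
def node {n : ℕ} (f : ℤˣ → BinaryTreeAut n) (s : ℤˣ) : BinaryTreeAut (n + 1) :=
  RegularWreathProduct.mk (D := IteratedWreathProduct ℤˣ n) f s

/-- The restriction of an automorphism to a half of the tree. -/
def half {n : ℕ} (x : BinaryTreeAut (n + 1)) : ℤˣ → BinaryTreeAut n :=
  RegularWreathProduct.left (D := IteratedWreathProduct ℤˣ n) x

/-- The action of an automorphism on the set of halves of the tree. -/
def root (n : ℕ) : BinaryTreeAut (n + 1) →* ℤˣ :=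
  RegularWreathProduct.rightHom (D := IteratedWreathProduct ℤˣ n)

@[simp]
theorem half_node {n : ℕ} (f : ℤˣ → BinaryTreeAut n) (s : ℤˣ) : half (node f s) = f := rfl

@[simp]
theorem root_node {n : ℕ} (f : ℤˣ → BinaryTreeAut n) (s : ℤˣ) : root n (node f s) = s := rfl

@[simp]
theorem half_one {n : ℕ} : half (1 : BinaryTreeAut (n + 1)) = 1 := rfl

theorem half_mul {n : ℕ} (x y : BinaryTreeAut (n + 1)) (q : ℤˣ) :
    half (x * y) q = half x q * half y (root n x * q) :=
  congrArg (fun s => half x q * half y (s * q)) (Int.units_inv_eq_self (root n x))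

theorem ext_halves {n : ℕ} {x y : BinaryTreeAut (n + 1)} (h₁ : half x 1 = half y 1)
    (h₂ : half x (-1) = half y (-1)) (h : root n x = root n y) : x = y := by
  refine RegularWreathProduct.ext (funext fun q => ?_) h
  rcases Int.units_eq_one_or q with rfl | rfl
  · exact h₁
  · exact h₂

/-- The parity of the number of swaps performed at the vertices of depth `j`. -/
def levelParity : (n j : ℕ) → BinaryTreeAut n →* ℤˣ
  | 0, _ => 1
  | n + 1, 0 => root n
  | n + 1, j + 1 =>
    MonoidHom.mk' (fun x => levelParity n j (half x 1) * levelParity n j (half x (-1))) fun x y => by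
      rcases Int.units_eq_one_or (root n x) with h | h <;>
        simp [half_mul, h, mul_comm, mul_left_comm]

theorem levelParity_succ_zero (n : ℕ) : levelParity (n + 1) 0 = root n := rfl

theorem levelParity_succ_succ (n j : ℕ) (x : BinaryTreeAut (n + 1)) :
    levelParity (n + 1) (j + 1) x = levelParity n j (half x 1) * levelParity n j (half x (-1)) :=
  rfl

/-- The embedding of the automorphism group of the first half of the tree. -/
def inFirst (n : ℕ) : BinaryTreeAut n →* BinaryTreeAut (n + 1) :=
  MonoidHom.mk' (fun a => node (Pi.mulSingle 1 a) 1) fun a b => by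
    apply ext_halves <;> simp [half_mul]

@[simp]
theorem half_inFirst {n : ℕ} (a : BinaryTreeAut n) : half (inFirst n a) = Pi.mulSingle 1 a := rfl

@[simp]
theorem root_inFirst {n : ℕ} (a : BinaryTreeAut n) : root n (inFirst n a) = 1 := rfl

/-- The swap at the leftmost vertex of depth `i`. -/
def swapAt : (n i : ℕ) → BinaryTreeAut n
  | 0, _ => 1
  | _ + 1, 0 => node 1 (-1)
  | n + 1, i + 1 => inFirst n (swapAt n i)

theorem swapAt_succ_zero (n : ℕ) : swapAt (n + 1) 0 = node 1 (-1) := rfl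

theorem swapAt_succ_succ (n i : ℕ) : swapAt (n + 1) (i + 1) = inFirst n (swapAt n i) := rfl

/-- The product of the leftmost swaps of maximal depth in the two halves of the tree. -/
def doubleSwap (n : ℕ) : BinaryTreeAut (n + 1) :=
  node (fun _ => swapAt n (n - 1)) 1

theorem levelParity_swapAt {n i : ℕ} (hi : i < n) (j : ℕ) :
    levelParity n j (swapAt n i) = if j = i then -1 else 1 := by
  induction n generalizing i j with
  | zero => omega
  | succ n ih =>
    rcases i with _ | i <;> rcases j with _ | j
    · rfl
    · simp [levelParity_succ_succ, swapAt_succ_zero]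
    · simp [levelParity_succ_zero, swapAt_succ_succ]
    · simp [levelParity_succ_succ, swapAt_succ_succ, ih (Nat.lt_of_succ_lt_succ hi) j]

theorem swapAt_mul_self (n i : ℕ) : swapAt n i * swapAt n i = 1 := by
  induction n generalizing i with
  | zero => rfl
  | succ n ih =>
    rcases i with _ | i
    · apply ext_halves <;> simp [half_mul, swapAt_succ_zero]
    · rw [swapAt_succ_succ, ← map_mul, ih, map_one]

/-- The automorphisms with an even number of swaps of maximal depth. -/
def evenSubgroup (n : ℕ) : Subgroup (BinaryTreeAut (n + 1)) :=
  (levelParity (n + 1) n).ker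

theorem swapAt_mem_evenSubgroup {n i : ℕ} (hi : i < n) : swapAt (n + 1) i ∈ evenSubgroup n := by
  rw [evenSubgroup, MonoidHom.mem_ker, levelParity_swapAt (by omega), if_neg hi.ne']

theorem levelParity_doubleSwap (n j : ℕ) : levelParity (n + 1) j (doubleSwap n) = 1 := by
  rcases j with _ | j
  · rfl
  · exact Int.units_mul_self _

theorem doubleSwap_mem_evenSubgroup (n : ℕ) : doubleSwap n ∈ evenSubgroup n :=
  levelParity_doubleSwap _ _

theorem inFirst_mem_evenSubgroup {n : ℕ} {a : BinaryTreeAut (n + 1)} (ha : a ∈ evenSubgroup n) :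
    inFirst (n + 1) a ∈ evenSubgroup (n + 1) := by
  have ha' : levelParity (n + 1) n a = 1 := ha
  change levelParity (n + 2) (n + 1) _ = 1
  simp [levelParity_succ_succ (n + 1), ha']

theorem levelParity_half_eq {n : ℕ} {x : BinaryTreeAut (n + 2)}
    (hx : x ∈ evenSubgroup (n + 1)) (q : ℤˣ) :
    levelParity (n + 1) n (half x q) = levelParity (n + 1) n (half x 1) := by
  have h : levelParity (n + 1) n (half x 1) * levelParity (n + 1) n (half x (-1)) = 1 := hx
  rcases Int.units_eq_one_or q with rfl | rfl
  · rfl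
  · rw [mul_eq_one_iff_inv_eq.mp h |>.symm, Int.units_inv_eq_self]

/-- The parity of the number of swaps of maximal depth in the first half of the tree. -/
def halfParity (n : ℕ) : evenSubgroup (n + 1) →* ℤˣ :=
  MonoidHom.mk' (fun x => levelParity (n + 1) n (half x.1 1)) fun x y => by
    rw [Subgroup.coe_mul, half_mul, map_mul, levelParity_half_eq y.2]

/-- A character of `evenSubgroup n` that vanishes on the swaps of non-maximal depth and on the double
swap is trivial. -/
theorem character_eq_one {A : Type*} [CommGroup A] {n : ℕ} (χ : evenSubgroup n →* A)
    (hswap : ∀ x : evenSubgroup n, ∀ i < n, x.1 = swapAt (n + 1) i → χ x = 1)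
    (hdouble : ∀ x : evenSubgroup n, x.1 = doubleSwap n → χ x = 1) : χ = 1 := by
  induction n with
  | zero =>
    ext x
    have : x = 1 :=
      Subtype.ext (ext_halves (Subsingleton.elim _ _) (Subsingleton.elim _ _) x.2)
    rw [this, map_one, map_one]
  | succ m ih =>
    let S : evenSubgroup (m + 1) := ⟨_, swapAt_mem_evenSubgroup m.succ_pos⟩
    let D : evenSubgroup (m + 1) := ⟨_, doubleSwap_mem_evenSubgroup (m + 1)⟩
    have hS : χ S = 1 := hswap S 0 m.succ_pos rfl
    have hD : χ D = 1 := hdouble D rfl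
    have hSv : S.1 = node 1 (-1) := rfl
    have hDv : D.1 = node (fun _ => swapAt (m + 1) m) 1 := rfl
    let ι : evenSubgroup m →* evenSubgroup (m + 1) :=
      ((inFirst (m + 1)).comp (evenSubgroup m).subtype).codRestrict _
        fun a => inFirst_mem_evenSubgroup a.2
    have hιv : ∀ a, (ι a).1 = inFirst (m + 1) a.1 := fun _ => rfl
    have hι : χ.comp ι = 1 := by
      apply ih
      · rintro x i hi hx
        exact hswap _ (i + 1) (by omega) (congrArg (inFirst (m + 1)) hx)
      · rintro u hu
        rcases m with _ | m
        · have : u = 1 := Subtype.ext hu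
          rw [this, map_one]
        · let s : evenSubgroup (m + 1) := ⟨_, swapAt_mem_evenSubgroup m.succ_pos⟩
          have hsv : s.1 = node 1 (-1) := rfl
          have key : s.1 * swapAt (m + 2) (m + 1) = u.1 * swapAt (m + 2) (m + 1) * s.1 := by
            rw [hu, hsv]
            apply ext_halves <;>
              simp [half_mul, swapAt_succ_succ, doubleSwap, swapAt_mul_self]
          have key' : ι s * D = ι u * D * ι s := by
            apply Subtype.ext
            simp only [Subgroup.coe_mul, hιv, hDv]
            apply ext_halves <;> simp [half_mul, key]
          have := congrArg χ key'
          rw [map_mul, map_mul, map_mul, hD, mul_one, mul_one] at this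
          exact right_eq_mul.mp this
    have hfirst : ∀ x : evenSubgroup (m + 1), levelParity (m + 1) m (half x.1 1) = 1 →
        root (m + 1) x.1 = 1 → χ x = 1 := by
      intro x hx hr
      let a : evenSubgroup m := ⟨_, hx⟩
      let b : evenSubgroup m := ⟨_, (levelParity_half_eq x.2 (-1)).trans hx⟩
      have : x = ι a * (S * ι b * S) := by
        apply Subtype.ext
        simp only [Subgroup.coe_mul, hιv, hSv]
        apply ext_halves <;> simp [half_mul, hr, a, b]
      have ha : χ (ι a) = 1 := DFunLike.congr_fun hι a
      have hb : χ (ι b) = 1 := DFunLike.congr_fun hι b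
      rw [this, map_mul, map_mul, map_mul, ha, hb, hS, one_mul, one_mul, one_mul]
    have hright : ∀ x : evenSubgroup (m + 1), root (m + 1) x.1 = 1 → χ x = 1 := by
      intro x hr
      rcases Int.units_eq_one_or (levelParity (m + 1) m (half x.1 1)) with h | h
      · exact hfirst x h hr
      · have := hfirst (D * x)
          (by simp [half_mul, hDv, levelParity_swapAt, h]) (by simp [hDv, hr])
        rwa [map_mul, hD, one_mul] at this
    ext1 x
    rcases Int.units_eq_one_or (root (m + 1) x.1) with h | h
    · exact hright x h
    · have := hright (S * x) (by simp [hSv, h])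
      rwa [map_mul, hS, one_mul] at this

/-- The parities of the swaps of the different depths, the last one only over half of the tree. -/
def parities (m : ℕ) : evenSubgroup (m + 1) →* (Fin (m + 2) → ℤˣ) :=
  MonoidHom.mk' (fun x => Fin.snoc (fun i : Fin (m + 1) => levelParity (m + 2) i x.1)
    (halfParity m x)) fun x y => by
      ext1 i
      refine Fin.lastCases ?_ (fun i => ?_) i <;> simp

/-- The standard generators of `evenSubgroup (m + 1)`. -/
def generator (m : ℕ) : Fin (m + 2) → evenSubgroup (m + 1) :=
  Fin.snoc (fun i : Fin (m + 1) => ⟨swapAt (m + 2) i, swapAt_mem_evenSubgroup i.2⟩)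
    ⟨doubleSwap (m + 1), doubleSwap_mem_evenSubgroup (m + 1)⟩

theorem parities_generator (m : ℕ) (i : Fin (m + 2)) :
    parities m (generator m i) = Pi.mulSingle i (-1) := by
  ext1 j
  refine Fin.lastCases ?_ (fun i => ?_) i <;> refine Fin.lastCases ?_ (fun j => ?_) j
  · simp [parities, generator, halfParity, doubleSwap, levelParity_swapAt]
  · rw [Pi.mulSingle_eq_of_ne (Fin.castSucc_lt_last j).ne]
    simp [parities, generator, levelParity_doubleSwap]
  · rw [Pi.mulSingle_eq_of_ne (Fin.castSucc_lt_last i).ne']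
    simp only [parities, generator, halfParity, MonoidHom.mk'_apply, Fin.snoc_castSucc,
      Fin.snoc_last]
    rcases i with ⟨_ | i, hi⟩
    · simp [swapAt_succ_zero]
    · have : m ≠ i := by omega
      simp [swapAt_succ_succ (m + 1), levelParity_swapAt (show i < m + 1 by omega), this]
  · have hi : (i : ℕ) < m + 2 := by omega
    simp [parities, generator, levelParity_swapAt hi, Pi.mulSingle_apply, Fin.ext_iff]

theorem card (n : ℕ) : Nat.card (BinaryTreeAut n) = 2 ^ ∑ i ∈ Finset.range n, 2 ^ i :=
  (IteratedWreathProduct.card ℤˣ n).trans (by simp)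

theorem two_mul_card_evenSubgroup (n : ℕ) :
    2 * Nat.card (evenSubgroup n) = 2 ^ ∑ i ∈ Finset.range (n + 1), 2 ^ i := by
  have hsurj : Function.Surjective (levelParity (n + 1) n) := by
    intro y
    rcases Int.units_eq_one_or y with rfl | rfl
    · exact ⟨1, map_one _⟩
    · exact ⟨swapAt (n + 1) n, by simp [levelParity_swapAt]⟩
  rw [← card, ← (evenSubgroup n).index_mul_card, evenSubgroup, Subgroup.index_ker,
    MonoidHom.range_eq_top.mpr hsurj]
  simp

theorem isPGroup_evenSubgroup (n : ℕ) : IsPGroup 2 (evenSubgroup n) :=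
  (IsPGroup.of_card (card (n + 1))).to_subgroup _

theorem nonempty_quotient_frattini_evenSubgroup (m : ℕ) :
    Nonempty (evenSubgroup (m + 1) ⧸ frattini (evenSubgroup (m + 1)) ≃* (Fin (m + 2) → ℤˣ)) := by
  refine (isPGroup_evenSubgroup _).nonempty_quotient_frattini_mulEquiv (parities m) (generator m)
    (parities_generator m) fun χ h => character_eq_one χ (fun x i hi hx => ?_) fun x hx => ?_
  · rw [← h (Fin.castSucc ⟨i, hi⟩)]
    exact congrArg χ (Subtype.ext (by simp only [hx, generator, Fin.snoc_castSucc]))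
  · rw [← h (Fin.last _)]
    exact congrArg χ (Subtype.ext (by simp [hx, generator]))

/-- The action on the leaves of the tree. -/
def leafPerm (n : ℕ) : BinaryTreeAut n →* Equiv.Perm (Fin n → ℤˣ) :=
  iteratedWreathToPermHom ℤˣ n

theorem leafPerm_injective (n : ℕ) : Function.Injective (leafPerm n) :=
  iteratedWreathToPermHomInj ℤˣ n

open Equiv in
theorem sign_leafPerm_succ (n : ℕ) (x : BinaryTreeAut (n + 1)) :
    Perm.sign (leafPerm (n + 1) x) =
      Perm.sign (leafPerm n (half x 1)) * Perm.sign (leafPerm n (half x (-1))) *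
        root n x ^ 2 ^ n := by
  have h : leafPerm (n + 1) x = (Fin.succFunEquiv ℤˣ n).symm.permCongr
      (prodCongrLeft (fun q => leafPerm n (half x q)) *
        prodCongrRight fun _ => Equiv.mulLeft (root n x)) := Equiv.ext fun _ => rfl
  have hmul : ∀ s : ℤˣ, Perm.sign (Equiv.mulLeft s) = s := by decide
  rw [h, Perm.sign_permCongr, Perm.sign_mul, Perm.sign_prodCongrLeft, Perm.sign_prodCongrRight,
    UnitsInt.univ, Finset.prod_pair (by decide)]
  simp [hmul]

theorem sign_leafPerm (n : ℕ) (x : BinaryTreeAut (n + 1)) :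
    Equiv.Perm.sign (leafPerm (n + 1) x) = levelParity (n + 1) n x := by
  induction n with
  | zero =>
    rw [sign_leafPerm_succ, Subsingleton.elim (half x 1) 1, Subsingleton.elim (half x (-1)) 1]
    simp [levelParity_succ_zero]
  | succ n ih =>
    rw [sign_leafPerm_succ, ih, ih, levelParity_succ_succ, pow_succ', pow_mul, Int.units_sq,
      one_pow, mul_one]

/-- The action of `evenSubgroup n` on the leaves by even permutations. -/
def leafAlternating (n : ℕ) : evenSubgroup n →* alternatingGroup (Fin (n + 1) → ℤˣ) :=
  ((leafPerm (n + 1)).comp (evenSubgroup n).subtype).codRestrict _ fun x =>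
    Equiv.Perm.mem_alternatingGroup.mpr ((sign_leafPerm n x.1).trans x.2)

theorem leafAlternating_injective (n : ℕ) : Function.Injective (leafAlternating n) :=
  fun _ _ h => Subtype.ext (leafPerm_injective _ (congrArg Subtype.val h))

/-- `evenSubgroup n` is isomorphic to the Sylow `2`-subgroups of the alternating group of degree
`2 ^ (n + 1)`. -/
theorem nonempty_sylow_mulEquiv (n : ℕ) (P : Sylow 2 (alternatingGroup (Fin (2 ^ (n + 1))))) :
    Nonempty (P ≃* evenSubgroup n) := by
  have : Nontrivial (Fin (2 ^ (n + 1))) :=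
    Fin.nontrivial_iff_two_le.mpr (Nat.le_self_pow n.succ_ne_zero 2)
  let e : (Fin (n + 1) → ℤˣ) ≃ Fin (2 ^ (n + 1)) := Fintype.equivFinOfCardEq (by simp)
  let f := e.altCongrHom.toMonoidHom.comp (leafAlternating n)
  have hf : Function.Injective f := e.altCongrHom.injective.comp (leafAlternating_injective n)
  let g := MonoidHom.ofInjective hf
  have hfact : (Nat.card (alternatingGroup (Fin (2 ^ (n + 1))))).factorization 2 + 1 =
      ∑ i ∈ Finset.range (n + 1), 2 ^ i := by
    rw [← Nat.Prime.multiplicity_factorial_pow Nat.prime_two,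
      Nat.multiplicity_eq_factorization Nat.prime_two (Nat.factorial_ne_zero _),
      ← Nat.card_fin (2 ^ (n + 1)), ← Nat.card_perm, ← two_mul_nat_card_alternatingGroup,
      Nat.card_fin, Nat.factorization_mul two_ne_zero Nat.card_pos.ne', Finsupp.add_apply,
      Nat.Prime.factorization_self Nat.prime_two, add_comm]
  let Q : Sylow 2 (alternatingGroup (Fin (2 ^ (n + 1)))) := Sylow.ofCard f.range (by
    rw [← Nat.card_congr g.toEquiv]
    apply Nat.eq_of_mul_eq_mul_left two_pos
    rw [two_mul_card_evenSubgroup, ← hfact, pow_succ'])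
  exact ⟨(P.equiv Q).trans g.symm⟩

end BinaryTreeAut

/-- For `k ≥ 2` and `P` a Sylow 2-subgroup of `A_{2^k}`, the quotient of `P` by its
Frattini subgroup is isomorphic to the elementary abelian group `(ZMod 2)^k`; in
particular this quotient has order `2^k`. -/
theorem stmt_10 (k : ℕ) (hk : 2 ≤ k) (P : Sylow 2 (alternatingGroup (Fin (2 ^ k)))) :
    Nonempty ((P ⧸ frattini P) ≃* Multiplicative (Fin k → ZMod 2)) ∧
    Nat.card (P ⧸ frattini P) = 2 ^ k := by
  obtain ⟨m, rfl⟩ := Nat.exists_eq_add_of_le' hk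
  obtain ⟨e₁⟩ := BinaryTreeAut.nonempty_sylow_mulEquiv (m + 1) P
  obtain ⟨e₂⟩ := nonempty_quotient_frattini_congr e₁
  obtain ⟨e₃⟩ := BinaryTreeAut.nonempty_quotient_frattini_evenSubgroup m
  let c : ℤˣ ≃* Multiplicative (ZMod 2) := mulEquivOfPrimeCardEq (p := 2) (by simp) (by simp)
  let e : (P ⧸ frattini P) ≃* Multiplicative (Fin (m + 2) → ZMod 2) :=
    ((e₂.trans e₃).trans (MulEquiv.piCongrRight fun _ => c)).trans
      (MulEquiv.funMultiplicative (Fin (m + 2)) (ZMod 2)).symm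
  refine ⟨⟨e⟩, ?_⟩
  rw [Nat.card_congr (e₂.trans e₃).toEquiv]
  simp
end

section
/- For every k ≥ 1, any Sylow 2-subgroup of the alternating group A_{4k+2} is isomorphic as a group to any Sylow 2-subgroup of the symmetric group S_{4k}. -/
/-- If `f : G →* H` is an injective homomorphism of finite groups and `p` has the same
multiplicity in `|G|` and `|H|`, then `G` and `H` have isomorphic Sylow `p`-subgroups. -/
theorem Sylow.nonempty_mulEquiv_of_injective {G H : Type*} [Group G] [Group H] [Finite G]
    [Finite H] {p : ℕ} [Fact p.Prime] (f : G →* H) (hf : Function.Injective f)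
    (hcard : (Nat.card G).factorization p = (Nat.card H).factorization p)
    (P : Sylow p H) (Q : Sylow p G) : Nonempty (P ≃* Q) := by
  let R : Sylow p H := Sylow.ofCard ((Q : Subgroup G).map f) (by
    rw [Subgroup.card_map_of_injective hf, Q.card_eq_multiplicity, hcard])
  exact ⟨(P.equiv R).trans ((Q : Subgroup G).equivMapOfInjective f hf).symm⟩

/-- A permutation of `α`, extended to `α ⊕ ℤˣ` by multiplication by its sign. -/
def Equiv.Perm.sumSignHom (α : Type*) [Fintype α] [DecidableEq α] :
    Equiv.Perm α →* Equiv.Perm (α ⊕ ℤˣ) :=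
  (Equiv.Perm.sumCongrHom α ℤˣ).comp
    ((MonoidHom.id _).prod ((MulAction.toPermHom ℤˣ ℤˣ).comp Equiv.Perm.sign))

theorem Equiv.Perm.sumSignHom_injective (α : Type*) [Fintype α] [DecidableEq α] :
    Function.Injective (Equiv.Perm.sumSignHom α) :=
  Equiv.Perm.sumCongrHom_injective.comp fun _ _ h => congrArg Prod.fst h

theorem Equiv.Perm.sign_toPerm_units_int (u : ℤˣ) :
    Equiv.Perm.sign (MulAction.toPerm u : Equiv.Perm ℤˣ) = u := by
  revert u
  decide

theorem Equiv.Perm.sign_sumSignHom {α : Type*} [Fintype α] [DecidableEq α] (σ : Equiv.Perm α) :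
    Equiv.Perm.sign (Equiv.Perm.sumSignHom α σ) = 1 := by
  change Equiv.Perm.sign (Equiv.Perm.sumCongr σ (MulAction.toPerm (Equiv.Perm.sign σ))) = 1
  rw [Equiv.Perm.sign_sumCongr, Equiv.Perm.sign_toPerm_units_int, Int.units_mul_self]

/-- The symmetric group on `n` letters embeds into the alternating group on `n + 2` letters. -/
theorem alternatingGroup.exists_injective_perm_fin (n : ℕ) :
    ∃ f : Equiv.Perm (Fin n) →* alternatingGroup (Fin (n + 2)), Function.Injective f := by
  let e : Fin n ⊕ ℤˣ ≃ Fin (n + 2) := Fintype.equivFinOfCardEq (by simp)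
  let g : Equiv.Perm (Fin n) →* Equiv.Perm (Fin (n + 2)) :=
    (e.permCongrHom : _ →* _).comp (Equiv.Perm.sumSignHom (Fin n))
  have hg : Function.Injective g :=
    e.permCongrHom.injective.comp (Equiv.Perm.sumSignHom_injective _)
  refine ⟨g.codRestrict _ fun σ => ?_, fun _ _ h => hg (congrArg Subtype.val h)⟩
  rw [Equiv.Perm.mem_alternatingGroup]
  exact (Equiv.Perm.sign_permCongr e _).trans (Equiv.Perm.sign_sumSignHom σ)

theorem alternatingGroup.nat_card_fin_four_mul_add_two (k : ℕ) :
    Nat.card (alternatingGroup (Fin (4 * k + 2))) =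
      (2 * k + 1) * (4 * k + 1) * Nat.card (Equiv.Perm (Fin (4 * k))) := by
  have h := two_mul_nat_card_alternatingGroup (α := Fin (4 * k + 2))
  simp only [Nat.card_perm, Nat.card_fin, Nat.factorial_succ] at h ⊢
  linarith

/-- For `k ≥ 1`, any Sylow 2-subgroup of `A_{4k+2}` is isomorphic to any Sylow
2-subgroup of `S_{4k}`. -/
theorem stmt_11 (k : ℕ) (hk : 1 ≤ k)
    (P : Sylow 2 (alternatingGroup (Fin (4 * k + 2))))
    (Q : Sylow 2 (Equiv.Perm (Fin (4 * k)))) :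
    Nonempty (P ≃* Q) := by
  obtain ⟨f, hf⟩ := alternatingGroup.exists_injective_perm_fin (4 * k)
  refine Sylow.nonempty_mulEquiv_of_injective f hf ?_ P Q
  have hodd : ¬ 2 ∣ (2 * k + 1) * (4 * k + 1) := by
    rw [Nat.prime_two.dvd_mul]
    omega
  rw [alternatingGroup.nat_card_fin_four_mul_add_two,
    Nat.factorization_mul (by positivity) Nat.card_pos.ne', Finsupp.add_apply,
    Nat.factorization_eq_zero_of_not_dvd hodd, zero_add]
end
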